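/- Let G be a simple graph on vertex set ℕ satisfying the extension property. Then the automorphism group Aut(G) has uncountable cofinality: there is no countable strictly increasing chain of proper subgroups of Aut(G) whose union is Aut(G). -/

import Mathlib

/-- A simple graph on `ℕ` has the extension property (i.e. is a Rado graph) if for all
disjoint finite sets `A`, `B` of vertices there is a vertex outside `A ∪ B` adjacent to
every vertex of `A` and to no vertex of `B`. -/
def SimpleGraph.ExtensionProperty (G : SimpleGraph ℕ) : Prop :=
  ∀ A B : Finset ℕ, Disjoint A B →
    ∃ v : ℕ, v ∉ A ∪ B ∧ (∀ a ∈ A, G.Adj v a) ∧ ∀ b ∈ B, ¬G.Adj v b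

namespace RadoCof

/-- `h` is an isomorphism from the subgraph of `Γ` induced on `S` onto its image in `G`. -/
def IsoOn {V : Type} (Γ : SimpleGraph V) (G : SimpleGraph ℕ) (S : Finset V) (h : V → ℕ) : Prop :=
  ∀ x ∈ S, ∀ y ∈ S, (h x = h y → x = y) ∧ (G.Adj (h x) (h y) ↔ Γ.Adj x y)

theorem ext_one {V : Type} [DecidableEq V] {Γ : SimpleGraph V} {G : SimpleGraph ℕ}
    (hG : G.ExtensionProperty) {S : Finset V} {h : V → ℕ} (hh : IsoOn Γ G S h)
    (Z : Finset ℕ) (v : V) (hv : v ∉ S) :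
    ∃ a, a ∉ Z ∧ (∀ z ∈ Z, z ∉ S.image h → ¬ G.Adj a z) ∧
      IsoOn Γ G (insert v S) (Function.update h v a) := by
  classical
  obtain ⟨a, ha, ha1, ha2⟩ := hG ((S.filter (fun x => Γ.Adj x v)).image h)
    ((Z ∪ S.image h) \ ((S.filter (fun x => Γ.Adj x v)).image h)) Finset.disjoint_sdiff
  have key : a ∉ Z ∪ S.image h := by
    intro h1
    apply ha
    rw [Finset.union_sdiff_self_eq_union]
    exact Finset.mem_union_right _ h1
  have hadj : ∀ x ∈ S, (G.Adj a (h x) ↔ Γ.Adj v x) := by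
    intro x hx
    constructor
    · intro h1
      by_contra h2
      refine ha2 (h x) ?_ h1
      simp only [Finset.mem_sdiff, Finset.mem_union, Finset.mem_image, Finset.mem_filter]
      refine ⟨Or.inr ⟨x, hx, rfl⟩, ?_⟩
      rintro ⟨y, ⟨hy, hy2⟩, hyx⟩
      have := (hh y hy x hx).1 hyx
      subst this
      exact h2 hy2.symm
    · intro h1
      apply ha1
      exact Finset.mem_image_of_mem _ (Finset.mem_filter.2 ⟨hx, h1.symm⟩)
  have hne : ∀ x ∈ S, a ≠ h x := by
    intro x hx h1
    apply key
    rw [h1]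
    exact Finset.mem_union_right _ (Finset.mem_image_of_mem _ hx)
  refine ⟨a, fun h1 => key (Finset.mem_union_left _ h1), ?_, ?_⟩
  · intro z hz hz2
    apply ha2
    simp only [Finset.mem_sdiff, Finset.mem_union]
    refine ⟨Or.inl hz, fun h3 => hz2 ?_⟩
    exact Finset.image_subset_image (Finset.filter_subset _ _) h3
  · intro x hx y hy
    have hx' := Finset.mem_insert.1 hx
    have hy' := Finset.mem_insert.1 hy
    by_cases hxv : x = v
    · by_cases hyv : y = v
      · subst hxv; subst hyv; simp
      · subst hxv
        have hyS : y ∈ S := by tauto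
        simp only [Function.update_self, Function.update_of_ne hyv]
        exact ⟨fun h1 => (hne y hyS h1).elim, hadj y hyS⟩
    · have hxS : x ∈ S := by tauto
      by_cases hyv : y = v
      · subst hyv
        simp only [Function.update_self, Function.update_of_ne hxv]
        refine ⟨fun h1 => (hne x hxS h1.symm).elim, ?_⟩
        rw [G.adj_comm, Γ.adj_comm]
        exact hadj x hxS
      · have hyS : y ∈ S := by tauto
        simp only [Function.update_of_ne hxv, Function.update_of_ne hyv]
        exact hh x hxS y hyS

theorem ext_all {V : Type} [DecidableEq V] {Γ : SimpleGraph V} {G : SimpleGraph ℕ}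
    (hG : G.ExtensionProperty) {S : Finset V} {h : V → ℕ} (hh : IsoOn Γ G S h)
    (Z : Finset ℕ) (T : Finset V) :
    ∃ h' : V → ℕ, (∀ x ∈ S, h' x = h x) ∧ IsoOn Γ G (T ∪ S) h' ∧
      ∀ x ∈ T, x ∉ S → h' x ∉ Z ∧ ∀ z ∈ Z, z ∉ S.image h → ¬ G.Adj (h' x) z := by
  classical
  induction T using Finset.induction_on with
  | empty => exact ⟨h, fun _ _ => rfl, by simpa using hh, by simp⟩
  | insert v T hv ih =>
    obtain ⟨k, hk1, hk2, hk3⟩ := ih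
    by_cases hvS : v ∈ S
    · refine ⟨k, hk1, ?_, ?_⟩
      · have : insert v T ∪ S = T ∪ S := by
          ext x; simp only [Finset.mem_union, Finset.mem_insert]
          constructor
          · rintro ((rfl | h) | h) <;> tauto
          · tauto
        rw [this]; exact hk2
      · intro x hx hxS
        rcases Finset.mem_insert.1 hx with rfl | hx
        · exact (hxS hvS).elim
        · exact hk3 x hx hxS
    · have hvn : v ∉ T ∪ S := by simp [hv, hvS]
      obtain ⟨a, ha1, ha2, ha3⟩ := ext_one hG hk2 (Z ∪ (T ∪ S).image k) v hvn
      -- we need non-adjacency also to the elements of `Z` hit by `k` on `T`, which there are none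
      refine ⟨Function.update k v a, ?_, ?_, ?_⟩
      · intro x hx
        rw [Function.update_of_ne (by rintro rfl; exact hvS hx)]
        exact hk1 x hx
      · rw [Finset.insert_union]; exact ha3
      · intro x hx hxS
        by_cases hxv : x = v
        · subst hxv
          simp only [Function.update_self]
          refine ⟨fun h1 => ha1 (Finset.mem_union_left _ h1), fun z hz hzS => ?_⟩
          apply ha2 z (Finset.mem_union_left _ hz)
          intro h1
          obtain ⟨y, hy, rfl⟩ := Finset.mem_image.1 h1
          by_cases hyS : y ∈ S
          · apply hzS
            rw [hk1 y hyS]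
            exact Finset.mem_image_of_mem _ hyS
          · have hyT : y ∈ T := by
              rcases Finset.mem_union.1 hy with h | h
              · exact h
              · exact (hyS h).elim
            exact (hk3 y hyT hyS).1 hz
        · rw [Function.update_of_ne hxv]
          have hxT : x ∈ T := by
            rcases Finset.mem_insert.1 hx with h | h
            · exact (hxv h).elim
            · exact h
          exact hk3 x hxT hxS

theorem exists_seq {σ : Type} (P : ℕ → σ → Prop) (R : ℕ → σ → σ → Prop) (s0 : σ) (h0 : P 0 s0)
    (step : ∀ n s, P n s → ∃ s', P (n + 1) s' ∧ R n s s') :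
    ∃ s : ℕ → σ, s 0 = s0 ∧ (∀ n, P n (s n)) ∧ ∀ n, R n (s n) (s (n + 1)) := by
  classical
  choose! nx hnx1 hnx2 using step
  let s : ℕ → σ := fun n => Nat.rec s0 (fun n s => nx n s) n
  have hP : ∀ n, P n (s n) := by
    intro n
    induction n with
    | zero => exact h0
    | succ n ih => exact hnx1 n _ ih
  exact ⟨s, rfl, hP, fun n => hnx2 n _ (hP n)⟩

theorem limit_fun {G : SimpleGraph ℕ} (F : ℕ → Finset ℕ) (w : ℕ → ℕ → ℕ)
    (hmono : ∀ n, F n ⊆ F (n + 1)) (hw : ∀ n, ∀ x ∈ F n, w (n + 1) x = w n x)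
    (hiso : ∀ n, IsoOn G G (F n) (w n)) (hdom : ∀ n, n ∈ F (n + 1))
    (hran : ∀ n, ∃ x ∈ F (n + 1), w (n + 1) x = n) :
    ∃ u : G ≃g G, ∀ n, ∀ x ∈ F n, u x = w n x := by
  have hm : Monotone F := monotone_nat_of_le_succ hmono
  have hw' : ∀ m n, m ≤ n → ∀ x ∈ F m, w n x = w m x := by
    intro m n hmn
    induction n, hmn using Nat.le_induction with
    | base => simp
    | succ n hmn ih =>
      intro x hx
      rw [hw n x (hm hmn hx), ih x hx]
  let u : ℕ → ℕ := fun x => w (x + 1) x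
  have hu : ∀ n, ∀ x ∈ F n, u x = w n x := by
    intro n x hx
    rcases le_total n (x + 1) with h | h
    · exact hw' _ _ h x hx
    · exact (hw' _ _ h x (hdom x)).symm
  have hall : ∀ x y, (u x = u y → x = y) ∧ (G.Adj (u x) (u y) ↔ G.Adj x y) := by
    intro x y
    have hx : x ∈ F (max (x + 1) (y + 1)) := hm (le_max_left _ _) (hdom x)
    have hy : y ∈ F (max (x + 1) (y + 1)) := hm (le_max_right _ _) (hdom y)
    rw [hu _ x hx, hu _ y hy]
    exact hiso _ x hx y hy
  have hsurj : Function.Surjective u := by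
    intro y
    obtain ⟨x, hx, hxy⟩ := hran y
    exact ⟨x, by rw [hu _ x hx, hxy]⟩
  let e : ℕ ≃ ℕ := Equiv.ofBijective u ⟨fun x y => (hall x y).1, hsurj⟩
  exact ⟨⟨e, by intro x y; exact (hall x y).2⟩, hu⟩

theorem isoOn_aut {G : SimpleGraph ℕ} (g : G ≃g G) (S : Finset ℕ) : IsoOn G G S g :=
  fun _ _ _ _ => ⟨fun h => g.injective h, g.map_adj_iff⟩

theorem ext_range {G : SimpleGraph ℕ} (hG : G.ExtensionProperty) {S : Finset ℕ} {h : ℕ → ℕ}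
    (hh : IsoOn G G S h) (n : ℕ) :
    ∃ (T : Finset ℕ) (k : ℕ → ℕ), S ⊆ T ∧ (∀ x ∈ S, k x = h x) ∧ IsoOn G G T k ∧
      ∃ x ∈ T, k x = n := by
  classical
  by_cases hn : ∃ x ∈ S, h x = n
  · exact ⟨S, h, subset_rfl, fun _ _ => rfl, hh, hn⟩
  · push Not at hn
    obtain ⟨a, ha, ha1, ha2⟩ := hG (S.filter (fun x => G.Adj n (h x)))
      (S.filter (fun x => ¬ G.Adj n (h x))) (Finset.disjoint_filter_filter_not _ _ _)
    have haS : a ∉ S := by rwa [Finset.filter_union_filter_not_eq] at ha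
    have hadj : ∀ x ∈ S, (G.Adj n (h x) ↔ G.Adj a x) := by
      intro x hx
      constructor
      · intro h1; exact ha1 x (Finset.mem_filter.2 ⟨hx, h1⟩)
      · intro h1; by_contra h2
        exact ha2 x (Finset.mem_filter.2 ⟨hx, h2⟩) h1
    refine ⟨insert a S, Function.update h a n, Finset.subset_insert _ _, ?_, ?_, a,
      Finset.mem_insert_self _ _, by simp⟩
    · intro x hx
      rw [Function.update_of_ne (by rintro rfl; exact haS hx)]
    · intro x hx y hy
      have hx' := Finset.mem_insert.1 hx
      have hy' := Finset.mem_insert.1 hy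
      by_cases hxv : x = a
      · by_cases hyv : y = a
        · subst hxv; subst hyv; simp
        · subst hxv
          have hyS : y ∈ S := by tauto
          simp only [Function.update_self, Function.update_of_ne hyv]
          exact ⟨fun h1 => (hn y hyS h1.symm).elim, hadj y hyS⟩
      · have hxS : x ∈ S := by tauto
        by_cases hyv : y = a
        · subst hyv
          simp only [Function.update_self, Function.update_of_ne hxv]
          refine ⟨fun h1 => (hn x hxS h1).elim, ?_⟩
          rw [G.adj_comm, G.adj_comm x]
          exact hadj x hxS
        · have hyS : y ∈ S := by tauto
          simp only [Function.update_of_ne hxv, Function.update_of_ne hyv]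
          exact hh x hxS y hyS

/-- Homogeneity of the random graph. -/
theorem homog {G : SimpleGraph ℕ} (hG : G.ExtensionProperty) {S : Finset ℕ} {h : ℕ → ℕ}
    (hh : IsoOn G G S h) : ∃ g : G ≃g G, ∀ x ∈ S, g x = h x := by
  classical
  obtain ⟨s, hs0, hs1, hs2⟩ := exists_seq (σ := Finset ℕ × (ℕ → ℕ))
    (fun _ s => IsoOn G G s.1 s.2)
    (fun n s s' => s.1 ⊆ s'.1 ∧ (∀ x ∈ s.1, s'.2 x = s.2 x) ∧ n ∈ s'.1 ∧ ∃ x ∈ s'.1, s'.2 x = n)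
    (S, h) hh (by
      rintro n ⟨F, k⟩ hk
      obtain ⟨k1, h1, h2, -⟩ := ext_all hG hk ∅ {n}
      obtain ⟨T, k2, h3, h4, h5, h6⟩ := ext_range hG h2 n
      refine ⟨(T, k2), h5, ?_, ?_, ?_, h6⟩
      · exact Finset.subset_union_right.trans h3
      · intro x hx
        have : x ∈ ({n} : Finset ℕ) ∪ F := Finset.mem_union_right _ hx
        exact (h4 x this).trans (h1 x hx)
      · exact h3 (by simp))
  obtain ⟨u, hu⟩ := limit_fun (G := G) (fun n => (s n).1) (fun n => (s n).2)
    (fun n => (hs2 n).1) (fun n => (hs2 n).2.1) hs1 (fun n => (hs2 n).2.2.1)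
    (fun n => (hs2 n).2.2.2)
  refine ⟨u, fun x hx => ?_⟩
  have := hu 0 x
  rw [hs0] at this
  exact this hx

/-- Free copies. -/
theorem free_copy {G : SimpleGraph ℕ} (hG : G.ExtensionProperty) (A B Z : Finset ℕ) :
    ∃ t : G ≃g G, (∀ x ∈ A, t x = x) ∧
      ∀ x ∈ B, x ∉ A → t x ∉ Z ∧ ∀ z ∈ Z, z ∉ A → ¬ G.Adj (t x) z := by
  classical
  obtain ⟨h, h1, h2, h3⟩ := ext_all hG (Γ := G) (S := A) (h := id)
    (fun x _ y _ => ⟨fun h => h, Iff.rfl⟩) Z B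
  obtain ⟨t, ht⟩ := homog hG h2
  refine ⟨t, ?_, ?_⟩
  · intro x hx
    rw [ht x (Finset.mem_union_right _ hx), h1 x hx]; rfl
  · intro x hx hxA
    rw [ht x (Finset.mem_union_left _ hx)]
    simpa using h3 x hx hxA

/-- Gluing two automorphisms along a free amalgam. -/
theorem glue {G : SimpleGraph ℕ} (hG : G.ExtensionProperty) (C D : Finset ℕ) (α β : G ≃g G)
    (h0 : ∀ x ∈ C, x ∈ D → α x = β x)
    (h1 : ∀ x ∈ C, x ∉ D → ∀ y ∈ D, y ∉ C → ¬ G.Adj x y)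
    (h2 : ∀ x ∈ C, x ∉ D → ∀ y ∈ D, y ∉ C → α x ≠ β y ∧ ¬ G.Adj (α x) (β y)) :
    ∃ c : G ≃g G, (∀ x ∈ C, c x = α x) ∧ ∀ x ∈ D, c x = β x := by
  classical
  let φ : ℕ → ℕ := fun x => if x ∈ C then α x else β x
  have hφC : ∀ x ∈ C, φ x = α x := fun x hx => by simp [φ, hx]
  have hφD : ∀ x ∈ D, φ x = β x := fun x hx => by
    by_cases hxC : x ∈ C
    · rw [hφC x hxC, h0 x hxC hx]
    · simp [φ, hxC]
  have hiso : IsoOn G G (C ∪ D) φ := by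
    have hα := fun x y => isoOn_aut α {x, y} x (by simp) y (by simp)
    have hβ := fun x y => isoOn_aut β {x, y} x (by simp) y (by simp)
    intro x hx y hy
    by_cases hxC : x ∈ C
    · by_cases hyC : y ∈ C
      · rw [hφC x hxC, hφC y hyC]; exact hα x y
      · have hyD : y ∈ D := by simp only [Finset.mem_union] at hy; tauto
        by_cases hxD : x ∈ D
        · rw [hφD x hxD, hφD y hyD]; exact hβ x y
        · rw [hφC x hxC, hφD y hyD]
          have := h2 x hxC hxD y hyD hyC
          have := h1 x hxC hxD y hyD hyC
          tauto
    · have hxD : x ∈ D := by simp only [Finset.mem_union] at hx; tauto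
      by_cases hyD : y ∈ D
      · rw [hφD x hxD, hφD y hyD]; exact hβ x y
      · have hyC : y ∈ C := by simp only [Finset.mem_union] at hy; tauto
        rw [hφD x hxD, hφC y hyC]
        have h3 := h2 y hyC hyD x hxD hxC
        have h4 := h1 y hyC hyD x hxD hxC
        rw [G.adj_comm, G.adj_comm x]
        refine ⟨fun h => (h3.1 h.symm).elim, ?_⟩
        tauto
  obtain ⟨c, hc⟩ := homog hG hiso
  exact ⟨c, fun x hx => by rw [hc x (Finset.mem_union_left _ hx), hφC x hx],
    fun x hx => by rw [hc x (Finset.mem_union_right _ hx), hφD x hx]⟩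

/-- `A` is invariant under `f 0, …, f (n-1)`. -/
def Inv {G : SimpleGraph ℕ} (n : ℕ) (f : ℕ → (G ≃g G)) (A : Finset ℕ) : Prop :=
  ∀ i < n, ∀ x ∈ A, f i x ∈ A

theorem mem_of_map_mem {G : SimpleGraph ℕ} {g : G ≃g G} {A : Finset ℕ}
    (h : ∀ x ∈ A, g x ∈ A) {x : ℕ} (hx : g x ∈ A) : x ∈ A := by
  classical
  have h1 : A.image g ⊆ A := by
    intro y hy
    obtain ⟨z, hz, rfl⟩ := Finset.mem_image.1 hy
    exact h z hz
  have h2 : A.image g = A :=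
    Finset.eq_of_subset_of_card_le h1 (by rw [Finset.card_image_of_injective _ g.injective])
  rw [← h2] at hx
  obtain ⟨z, hz, hzx⟩ := Finset.mem_image.1 hx
  rwa [← g.injective hzx]

/-- The Hubička–Konečný–Nešetřil graph of valuations. -/
def valGraph (V : Type) : SimpleGraph (V × (V → Bool)) where
  Adj x y := x.1 ≠ y.1 ∧ x.2 y.1 ≠ y.2 x.1
  symm := ⟨fun _ _ h => ⟨h.1.symm, h.2.symm⟩⟩
  loopless := ⟨fun _ h => h.1 rfl⟩

/-- Partial maps extend to the valuation graph. -/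
theorem val_extend {V : Type} [DecidableEq V] (χ : V → V → Bool) (p : Equiv.Perm V) (D : V → Prop)
    (hD : ∀ x y, D x → D y → ((χ x y ^^ χ y x) = (χ (p x) (p y) ^^ χ (p y) (p x)))) :
    ∃ θ : V × (V → Bool) → V × (V → Bool), Function.Injective θ ∧
      (∀ x y, (valGraph V).Adj (θ x) (θ y) ↔ (valGraph V).Adj x y) ∧
      ∀ x, D x → θ (x, χ x) = (p x, χ (p x)) := by
  classical
  let F : V → V → Bool := fun x y =>
    if D x then (χ (p x) (p y) ^^ χ x y) else if D y then (χ (p y) (p x) ^^ χ y x) else false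
  have hF : ∀ x y, F x y = F y x := by
    intro x y
    by_cases hx : D x <;> by_cases hy : D y <;> simp only [F, hx, hy, if_true, if_false]
    have := hD x y hx hy
    revert this
    generalize χ x y = a; generalize χ y x = b
    generalize χ (p x) (p y) = c; generalize χ (p y) (p x) = d
    revert a b c d; decide
  refine ⟨fun x => (p x.1, fun y => x.2 (p.symm y) ^^ F x.1 (p.symm y)), ?_, ?_, ?_⟩
  · rintro ⟨x, ξ⟩ ⟨y, η⟩ h
    simp only [Prod.mk.injEq, EmbeddingLike.apply_eq_iff_eq] at h
    obtain ⟨rfl, h⟩ := h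
    congr 1
    funext z
    have := congrFun h (p z)
    simpa using this
  · rintro ⟨x, ξ⟩ ⟨y, η⟩
    simp only [valGraph, ne_eq, EmbeddingLike.apply_eq_iff_eq, Equiv.symm_apply_apply]
    rw [hF y x]
    simp
  · intro x hx
    ext1
    · rfl
    · funext y
      simp [F, hx]
      generalize χ x (p.symm y) = a
      generalize χ (p x) y = b
      revert a b; decide

/-- Extension property for partial automorphisms (Hrushovski), inside the random graph. -/
theorem eppa {G : SimpleGraph ℕ} (hG : G.ExtensionProperty) (A : Finset ℕ) (g : ℕ → (G ≃g G)) :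
    ∃ (B : Finset ℕ) (b : ℕ → (G ≃g G)), A ⊆ B ∧ (∀ n, Inv n b B) ∧
      ∀ i, ∀ x ∈ A, g i x ∈ A → b i x = g i x := by
  classical
  let V := {x // x ∈ A}
  let χ : V → V → Bool := fun v u => decide (u.1 < v.1 ∧ G.Adj u.1 v.1)
  have hχ : ∀ x y : V, (χ x y ^^ χ y x) = decide (G.Adj x.1 y.1) := by
    intro x y
    rcases lt_trichotomy x.1 y.1 with h | h | h
    · have h' : ¬ y.1 < x.1 := h.not_gt
      simp only [χ, h, h', true_and, false_and, decide_false, Bool.false_bne]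
    · simp [χ, h]
    · have h' : ¬ x.1 < y.1 := h.not_gt
      simp only [χ, h, h', true_and, false_and, decide_false, Bool.bne_false, G.adj_comm]
  let e : V → V × (V → Bool) := fun v => (v, χ v)
  let S : Finset (V × (V → Bool)) := Finset.univ.image e
  have hS : IsoOn (valGraph V) G S (fun x => x.1.1) := by
    intro x hx y hy
    obtain ⟨v, -, rfl⟩ := Finset.mem_image.1 hx
    obtain ⟨u, -, rfl⟩ := Finset.mem_image.1 hy
    constructor
    · intro h
      have : v = u := Subtype.ext h
      rw [this]
    · show G.Adj v.1 u.1 ↔ v ≠ u ∧ χ v u ≠ χ u v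
      have := hχ v u
      constructor
      · intro h
        refine ⟨by rintro rfl; exact G.irrefl h, ?_⟩
        intro h2
        rw [h2] at this
        simp [h] at this
      · rintro ⟨-, h⟩
        by_contra h2
        apply h
        simp only [h2, decide_false] at this
        simpa using this
  obtain ⟨h, h1, h2, -⟩ := ext_all hG hS ∅ Finset.univ
  have h2' := fun x y => h2 x (by simp) y (by simp)
  have hinj : Function.Injective h := fun x y => (h2' x y).1
  have he : ∀ v : V, h (e v) = v.1 := fun v => h1 _ (Finset.mem_image_of_mem _ (Finset.mem_univ v))
  have hb : ∀ i, ∃ b : G ≃g G, (∀ x ∈ Finset.univ.image h, b x ∈ Finset.univ.image h) ∧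
      ∀ x ∈ A, g i x ∈ A → b x = g i x := by
    intro i
    obtain ⟨p, hp⟩ := Equiv.Perm.exists_extending_pair
      (α := {v : V // g i v.1 ∈ A}) (β := V) (fun v => v.1) (fun v => ⟨g i v.1.1, v.2⟩)
      Subtype.val_injective (by
        intro x y hxy
        have := congrArg Subtype.val hxy
        exact Subtype.ext (Subtype.ext ((g i).injective this)))
    have hp' : ∀ v : V, g i v.1 ∈ A → (p v).1 = g i v.1 := by
      intro v hv
      have := hp ⟨v, hv⟩
      rw [this]
    obtain ⟨θ, θ1, θ2, θ3⟩ := val_extend χ p (fun v => g i v.1 ∈ A) (by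
      intro x y hx hy
      rw [hχ, hχ, hp' x hx, hp' y hy]
      simp [(g i).map_adj_iff])
    let φ : ℕ → ℕ := Function.extend h (fun v => h (θ v)) id
    have hφ : ∀ v, φ (h v) = h (θ v) := fun v => hinj.extend_apply _ _ v
    obtain ⟨b, hb⟩ := homog hG (S := Finset.univ.image h) (h := φ) (by
      intro x hx y hy
      obtain ⟨v, -, rfl⟩ := Finset.mem_image.1 hx
      obtain ⟨u, -, rfl⟩ := Finset.mem_image.1 hy
      rw [hφ, hφ, (h2' _ _).2, θ2, (h2' _ _).2]
      exact ⟨fun h3 => congrArg h (θ1 (hinj h3)), Iff.rfl⟩)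
    refine ⟨b, ?_, ?_⟩
    · intro x hx
      rw [hb x hx]
      obtain ⟨v, -, rfl⟩ := Finset.mem_image.1 hx
      rw [hφ]
      simp
    · intro x hx hgx
      have hv := he ⟨x, hx⟩
      have : b x = φ x := hb x (by rw [Finset.mem_image]; exact ⟨_, Finset.mem_univ _, hv⟩)
      rw [this]
      have h3 := hφ (e ⟨x, hx⟩)
      rw [hv] at h3
      rw [h3]
      have h4 := θ3 ⟨x, hx⟩ hgx
      have h5 := he (p ⟨x, hx⟩)
      rw [hp' ⟨x, hx⟩ hgx] at h5
      rw [← h5]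
      exact congrArg h h4
  choose b hb1 hb2 using hb
  refine ⟨Finset.univ.image h, b, ?_, fun n i _ => hb1 i, hb2⟩
  intro x hx
  rw [Finset.mem_image]
  exact ⟨_, Finset.mem_univ _, he ⟨x, hx⟩⟩

/-- `U` contains a dense open set (for the topology of pointwise convergence). -/
def OpenDense {G : SimpleGraph ℕ} (U : Set (G ≃g G)) : Prop :=
  ∀ (v : G ≃g G) (E : Finset ℕ), ∃ (w : G ≃g G) (F : Finset ℕ), (∀ x ∈ E, w x = v x) ∧
    ∀ w' : G ≃g G, (∀ x ∈ F, w' x = w x) → w' ∈ U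

theorem baire_nat {G : SimpleGraph ℕ} (U : ℕ → Set (G ≃g G)) (hU : ∀ i, OpenDense (U i))
    (v : G ≃g G) (E : Finset ℕ) : ∃ u : G ≃g G, (∀ x ∈ E, u x = v x) ∧ ∀ i, u ∈ U i := by
  classical
  obtain ⟨s, hs0, -, hs2⟩ := exists_seq (σ := Finset ℕ × (G ≃g G))
    (fun _ _ => True)
    (fun n s s' => (s.1 ⊆ s'.1 ∧ (∀ x ∈ s.1, s'.2 x = s.2 x) ∧ n ∈ s'.1 ∧
      ∃ x ∈ s'.1, s'.2 x = n) ∧ ∀ w' : G ≃g G, (∀ x ∈ s'.1, w' x = s'.2 x) → w' ∈ U n)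
    (E, v) trivial (by
      rintro n ⟨F, k⟩ -
      obtain ⟨w, F', h1, h2⟩ := hU n k F
      refine ⟨(F ∪ F' ∪ {n, w.symm n}, w), trivial, ⟨?_, h1, by simp, w.symm n, by simp, by simp⟩, ?_⟩
      · intro x hx; simp [hx]
      · intro w' hw'
        exact h2 w' (fun x hx => hw' x (by simp [hx])))
  obtain ⟨u, hu⟩ := limit_fun (G := G) (fun n => (s n).1) (fun n => (s n).2)
    (fun n => (hs2 n).1.1) (fun n => (hs2 n).1.2.1) (fun n => isoOn_aut _ _)
    (fun n => (hs2 n).1.2.2.1) (fun n => (hs2 n).1.2.2.2)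
  refine ⟨u, ?_, fun i => (hs2 i).2 u (hu (i + 1))⟩
  have := hu 0
  rwa [hs0] at this

theorem baire {G : SimpleGraph ℕ} {I : Type} [Countable I] (U : I → Set (G ≃g G))
    (hU : ∀ i, OpenDense (U i))
    (v : G ≃g G) (E : Finset ℕ) : ∃ u : G ≃g G, (∀ x ∈ E, u x = v x) ∧ ∀ i, u ∈ U i := by
  rcases isEmpty_or_nonempty I with hI | hI
  · exact ⟨v, fun _ _ => rfl, fun i => (hI.false i).elim⟩
  · obtain ⟨k, hk⟩ := exists_surjective_nat I
    obtain ⟨u, hu, hu2⟩ := baire_nat (fun n => U (k n)) (fun n => hU _) v E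
    refine ⟨u, hu, fun i => ?_⟩
    obtain ⟨n, rfl⟩ := hk i
    exact hu2 n

theorem OpenDense.translate {G : SimpleGraph ℕ} {U : Set (G ≃g G)} (hU : OpenDense U)
    (g : G ≃g G) : OpenDense {u | g * u ∈ U} := by
  intro v E
  obtain ⟨w, F, h1, h2⟩ := hU (g * v) E
  refine ⟨g⁻¹ * w, F, ?_, ?_⟩
  · intro x hx
    rw [RelIso.mul_apply, h1 x hx, RelIso.mul_apply, RelIso.inv_apply_self]
  · intro w' hw'
    apply h2
    intro x hx
    rw [RelIso.mul_apply, hw' x hx, RelIso.mul_apply, RelIso.apply_inv_self]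

/-- Open subgroups are almost everything. -/
theorem open_subgroup {G : SimpleGraph ℕ} (hG : G.ExtensionProperty) (E : Finset ℕ) :
    ∃ t : G ≃g G, ∀ K : Subgroup (G ≃g G), (∀ g : G ≃g G, (∀ x ∈ E, g x = x) → g ∈ K) →
      t ∈ K → K = ⊤ := by
  classical
  obtain ⟨t, -, ht⟩ := free_copy hG ∅ E E
  simp only [Finset.notMem_empty, not_false_eq_true, forall_true_left] at ht
  have key : ∀ z : G ≃g G, (∀ x ∈ E, z x ∉ E ∧ ∀ y ∈ E, ¬ G.Adj (z x) y) →
      ∃ a : G ≃g G, (∀ x ∈ E, a x = x) ∧ ∀ x ∈ E, a (z x) = t x := by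
    intro z hz
    have glued : ∃ c : G ≃g G, (∀ x ∈ E, c x = (1 : G ≃g G) x) ∧ ∀ x ∈ E.image z, c x = (t * z⁻¹) x := by
      refine glue hG E (E.image z) 1 (t * z⁻¹) ?_ ?_ ?_
      · intro x hx hx2
        obtain ⟨y, hy, rfl⟩ := Finset.mem_image.1 hx2
        exact ((hz y hy).1 hx).elim
      · intro x hx _ y hyI _
        obtain ⟨y, hy, rfl⟩ := Finset.mem_image.1 hyI
        rw [G.adj_comm]
        exact (hz y hy).2 x hx
      · intro x hx _ y hyI _
        obtain ⟨y, hy, rfl⟩ := Finset.mem_image.1 hyI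
        rw [RelIso.mul_apply, RelIso.inv_apply_self, G.adj_comm]
        refine ⟨?_, (ht y hy).2 x hx⟩
        rintro (rfl : x = t y)
        exact (ht y hy).1 hx
    obtain ⟨a, ha1, ha2⟩ := glued
    refine ⟨a, ha1, fun x hx => ?_⟩
    rw [ha2 _ (Finset.mem_image_of_mem _ hx), RelIso.mul_apply, RelIso.inv_apply_self]
  refine ⟨t, fun K hK htK => ?_⟩
  rw [eq_top_iff]
  intro g _
  obtain ⟨z, -, hz⟩ := free_copy hG ∅ E (E ∪ E.image g.symm)
  simp only [Finset.notMem_empty, not_false_eq_true, forall_true_left] at hz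
  obtain ⟨a, ha1, ha2⟩ := key z (fun x hx =>
    ⟨fun h => (hz x hx).1 (Finset.mem_union_left _ h),
      fun y hy => (hz x hx).2 y (Finset.mem_union_left _ hy)⟩)
  obtain ⟨c, hc1, hc2⟩ := key (g * z) (fun x hx => by
    rw [RelIso.mul_apply]
    refine ⟨fun h => (hz x hx).1 (Finset.mem_union_right _ ?_), fun y hy h => ?_⟩
    · exact Finset.mem_image.2 ⟨_, h, by simp⟩
    · refine (hz x hx).2 (g.symm y) (Finset.mem_union_right _ (Finset.mem_image_of_mem _ hy)) ?_
      rw [← g.map_adj_iff]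
      simpa using h)
  have h1 : t⁻¹ * (c * g * a⁻¹) * t ∈ K := by
    apply hK
    intro x hx
    simp only [RelIso.mul_apply]
    rw [← ha2 x hx, RelIso.inv_apply_self]
    have := hc2 x hx
    rw [RelIso.mul_apply] at this
    rw [this, RelIso.inv_apply_self]
  have h2 : g = c⁻¹ * (t * (t⁻¹ * (c * g * a⁻¹) * t) * t⁻¹) * a := by group
  rw [h2]
  exact K.mul_mem (K.mul_mem (K.inv_mem (hK c hc1))
    (K.mul_mem (K.mul_mem htK h1) (K.inv_mem htK))) (hK a ha1)

/-- Generic tuples of automorphisms. -/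
def Gen {G : SimpleGraph ℕ} (n : ℕ) (f : ℕ → (G ≃g G)) : Prop :=
  (∀ E : Finset ℕ, ∃ A : Finset ℕ, E ⊆ A ∧ Inv n f A) ∧
  ∀ (A B : Finset ℕ) (b : ℕ → (G ≃g G)), A ⊆ B → Inv n f A → Inv n b B →
    (∀ i < n, ∀ x ∈ A, b i x = f i x) →
    ∃ h : G ≃g G, (∀ x ∈ A, h x = x) ∧ ∀ i < n, ∀ x ∈ B, h (b i x) = f i (h x)

theorem gen_zero {G : SimpleGraph ℕ} (f : ℕ → (G ≃g G)) : Gen 0 f :=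
  ⟨fun E => ⟨E, subset_rfl, fun i hi => absurd hi (Nat.not_lt_zero i)⟩,
    fun _ _ _ _ _ _ _ => ⟨1, fun _ _ => rfl, fun i hi => absurd hi (Nat.not_lt_zero i)⟩⟩

/-- The set of `u` for which `E` is contained in a finite `(f, u)`-invariant set. -/
def Req1 {G : SimpleGraph ℕ} (n : ℕ) (f : ℕ → (G ≃g G)) (E : Finset ℕ) : Set (G ≃g G) :=
  {u | ∃ A : Finset ℕ, E ⊆ A ∧ Inv n f A ∧ ∀ x ∈ A, u x ∈ A}

/-- The set of `u` solving the extension problem `(A, B, b)`. -/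
def Req2 {G : SimpleGraph ℕ} (n : ℕ) (f : ℕ → (G ≃g G)) (A B : Finset ℕ) (b : ℕ → (G ≃g G)) :
    Set (G ≃g G) :=
  {u | A ⊆ B → Inv n f A → (∀ x ∈ A, u x ∈ A) → Inv (n + 1) b B →
    (∀ i < n, ∀ x ∈ A, b i x = f i x) → (∀ x ∈ A, b n x = u x) →
    ∃ h : G ≃g G, (∀ x ∈ A, h x = x) ∧ (∀ i < n, ∀ x ∈ B, h (b i x) = f i (h x)) ∧
      ∀ x ∈ B, h (b n x) = u (h x)}

theorem dense1_aux {G : SimpleGraph ℕ} (hG : G.ExtensionProperty) {n : ℕ} {f : ℕ → (G ≃g G)}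
    (hf : Gen n f) (v : G ≃g G) (E0 E : Finset ℕ) :
    ∃ (w : G ≃g G) (A : Finset ℕ), (∀ x ∈ E0, w x = v x) ∧ E0 ⊆ A ∧ E ⊆ A ∧ Inv n f A ∧
      ∀ x ∈ A, w x ∈ A := by
  classical
  obtain ⟨A0, hA0, hA0inv⟩ := hf.1 (E0 ∪ E0.image v ∪ E)
  obtain ⟨B, b, hAB, hb1, hb2⟩ := eppa hG A0 (Function.update f n v)
  have hbf : ∀ i < n, ∀ x ∈ A0, b i x = f i x := by
    intro i hi x hx
    have := hb2 i x hx
    rw [Function.update_of_ne hi.ne] at this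
    exact this (hA0inv i hi x hx)
  have hbv : ∀ x ∈ E0, b n x = v x := by
    intro x hx
    have := hb2 n x (hA0 (by simp [hx]))
    rw [Function.update_self] at this
    refine this (hA0 ?_)
    have := Finset.mem_image_of_mem v hx
    simp only [Finset.mem_union]
    tauto
  obtain ⟨h, hh1, hh2⟩ := hf.2 A0 B b hAB hA0inv (hb1 n) hbf
  have hsub : A0 ⊆ B.image h := fun x hx => Finset.mem_image.2 ⟨x, hAB hx, hh1 x hx⟩
  refine ⟨h * b n * h⁻¹, B.image h, ?_, ?_, ?_, ?_, ?_⟩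
  · intro x hx
    have hxA : x ∈ A0 := hA0 (by simp [hx])
    have hvx : v x ∈ A0 := hA0 (by
      have := Finset.mem_image_of_mem v hx
      simp only [Finset.mem_union]
      tauto)
    have : h⁻¹ x = x := by
      conv_lhs => rw [← hh1 x hxA]
      rw [RelIso.inv_apply_self]
    simp only [RelIso.mul_apply]
    rw [this, hbv x hx, hh1 _ hvx]
  · exact fun x hx => hsub (hA0 (by simp [hx]))
  · exact fun x hx => hsub (hA0 (by simp [hx]))
  · intro i hi x hx
    obtain ⟨y, hy, rfl⟩ := Finset.mem_image.1 hx
    rw [← hh2 i hi y hy]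
    exact Finset.mem_image_of_mem _ (hb1 n i hi y hy)
  · intro x hx
    obtain ⟨y, hy, rfl⟩ := Finset.mem_image.1 hx
    simp only [RelIso.mul_apply]
    rw [RelIso.inv_apply_self]
    exact Finset.mem_image_of_mem _ (hb1 (n + 1) n (Nat.lt_succ_self n) y hy)

theorem dense1 {G : SimpleGraph ℕ} (hG : G.ExtensionProperty) {n : ℕ} {f : ℕ → (G ≃g G)}
    (hf : Gen n f) (E : Finset ℕ) : OpenDense (Req1 n f E) := by
  intro v E0
  obtain ⟨w, A, h1, -, h2, h3, h4⟩ := dense1_aux hG hf v E0 E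
  refine ⟨w, A, h1, fun w' hw' => ⟨A, h2, h3, fun x hx => ?_⟩⟩
  rw [hw' x hx]
  exact h4 x hx

theorem dense2_aux {G : SimpleGraph ℕ} (hG : G.ExtensionProperty) {n : ℕ} {f : ℕ → (G ≃g G)}
    (hf : Gen n f) (A B : Finset ℕ) (b : ℕ → (G ≃g G)) (v : G ≃g G) (E0 : Finset ℕ) :
    ∃ (w : G ≃g G) (F : Finset ℕ), (∀ x ∈ E0, w x = v x) ∧
    ∀ w' : G ≃g G, (∀ x ∈ F, w' x = w x) → w' ∈ Req2 n f A B b := by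
  classical
  obtain ⟨w, A1, hw, hE0, hA, hfA1, hwA1⟩ := dense1_aux hG hf v E0 A
  by_cases hyp : A ⊆ B ∧ Inv n f A ∧ (∀ x ∈ A, w x ∈ A) ∧ Inv (n + 1) b B ∧
    (∀ i < n, ∀ x ∈ A, b i x = f i x) ∧ (∀ x ∈ A, b n x = w x)
  · obtain ⟨hAB, hfA, hwA, hbB, hbf, hbw⟩ := hyp
    obtain ⟨t, ht1, ht2⟩ := free_copy hG A B A1
    let a : ℕ → (G ≃g G) := Function.update f n w
    have han : a n = w := Function.update_self _ _ _
    have haf : ∀ i < n, a i = f i := fun i hi => Function.update_of_ne hi.ne _ _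
    have haA1 : Inv (n + 1) a A1 := by
      intro i hi x hx
      rcases Nat.lt_succ_iff_lt_or_eq.1 hi with h | rfl
      · rw [haf i h]; exact hfA1 i h x hx
      · rw [han]; exact hwA1 x hx
    have haA : Inv (n + 1) a A := by
      intro i hi x hx
      rcases Nat.lt_succ_iff_lt_or_eq.1 hi with h | rfl
      · rw [haf i h]; exact hfA i h x hx
      · rw [han]; exact hwA x hx
    have hba : ∀ i < n + 1, ∀ x ∈ A, b i x = a i x := by
      intro i hi x hx
      rcases Nat.lt_succ_iff_lt_or_eq.1 hi with h | rfl
      · rw [haf i h]; exact hbf i h x hx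
      · rw [han]; exact hbw x hx
    have hbA : Inv (n + 1) b A := by
      intro i hi x hx
      rw [hba i hi x hx]; exact haA i hi x hx
    -- elements of the copy of `B` lying in `A1` are in `A`
    have hin : ∀ y ∈ B, t y ∈ A1 → y ∈ A := by
      intro y hy hty
      by_contra hyA
      exact (ht2 y hy hyA).1 hty
    have hc : ∀ i, ∃ c : G ≃g G, i < n + 1 →
        (∀ x ∈ A1, c x = a i x) ∧ ∀ x ∈ B, c (t x) = t (b i x) := by
      intro i
      by_cases hi : i < n + 1
      swap
      · exact ⟨1, fun h => absurd h hi⟩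
      have glued : ∃ c : G ≃g G, (∀ x ∈ A1, c x = a i x) ∧ ∀ x ∈ B.image t, c x = (t * b i * t⁻¹) x := by
        refine glue hG A1 (B.image t) (a i) (t * b i * t⁻¹) ?_ ?_ ?_
        · intro x hx hxt
          obtain ⟨y, hy, rfl⟩ := Finset.mem_image.1 hxt
          have hyA := hin y hy hx
          simp only [RelIso.mul_apply]
          rw [RelIso.inv_apply_self, ht1 _ (hbA i hi y hyA), ht1 y hyA, hba i hi y hyA]
        · intro x hx hxt y hyI hyA1
          obtain ⟨y, hy, rfl⟩ := Finset.mem_image.1 hyI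
          have hyA : y ∉ A := fun h => hyA1 (by rw [ht1 y h]; exact hA h)
          have hxA : x ∉ A := fun h => hxt (Finset.mem_image.2 ⟨x, hAB h, ht1 x h⟩)
          rw [G.adj_comm]
          exact (ht2 y hy hyA).2 x hx hxA
        · intro x hx hxt y hyI hyA1
          obtain ⟨y, hy, rfl⟩ := Finset.mem_image.1 hyI
          have hyA : y ∉ A := fun h => hyA1 (by rw [ht1 y h]; exact hA h)
          have hxA : x ∉ A := fun h => hxt (Finset.mem_image.2 ⟨x, hAB h, ht1 x h⟩)
          simp only [RelIso.mul_apply]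
          rw [RelIso.inv_apply_self]
          have hyA' : b i y ∉ A := fun h => hyA (mem_of_map_mem (hbA i hi) h)
          have hxA' : a i x ∉ A := fun h => hxA (mem_of_map_mem (haA i hi) h)
          have := ht2 (b i y) (hbB i hi y hy) hyA'
          rw [G.adj_comm]
          refine ⟨fun h => this.1 ?_, this.2 _ (haA1 i hi x hx) hxA'⟩
          rw [← h]
          exact haA1 i hi x hx
      obtain ⟨c, hc1, hc2⟩ := glued
      refine ⟨c, fun _ => ⟨hc1, fun x hx => ?_⟩⟩
      rw [hc2 _ (Finset.mem_image_of_mem _ hx)]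
      simp only [RelIso.mul_apply]
      rw [RelIso.inv_apply_self]
    choose c hc using hc
    have hcinv : Inv (n + 1) c (A1 ∪ B.image t) := by
      intro i hi x hx
      rcases Finset.mem_union.1 hx with hx | hx
      · rw [(hc i hi).1 x hx]
        exact Finset.mem_union_left _ (haA1 i hi x hx)
      · obtain ⟨y, hy, rfl⟩ := Finset.mem_image.1 hx
        rw [(hc i hi).2 y hy]
        exact Finset.mem_union_right _ (Finset.mem_image_of_mem _ (hbB i hi y hy))
    obtain ⟨h, hh1, hh2⟩ := hf.2 A1 (A1 ∪ B.image t) c Finset.subset_union_left hfA1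
      (fun i hi => hcinv i (Nat.lt_succ_of_lt hi))
      (fun i hi x hx => by rw [(hc i (Nat.lt_succ_of_lt hi)).1 x hx, haf i hi])
    have hn := Nat.lt_succ_self n
    have hww : ∀ x ∈ A1, (h * c n * h⁻¹) x = w x := by
      intro x hx
      have : h⁻¹ x = x := by
        conv_lhs => rw [← hh1 x hx]
        rw [RelIso.inv_apply_self]
      simp only [RelIso.mul_apply]
      rw [this, (hc n hn).1 x hx, han, hh1 _ (hwA1 x hx)]
    refine ⟨h * c n * h⁻¹, A1 ∪ (B.image t).image h, ?_, ?_⟩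
    · intro x hx
      rw [hww x (hE0 hx), hw x hx]
    · intro w' hw' _ _ _ _ _ _
      refine ⟨h * t, ?_, ?_, ?_⟩
      · intro x hx
        rw [RelIso.mul_apply, ht1 x hx, hh1 x (hA hx)]
      · intro i hi x hx
        rw [RelIso.mul_apply, RelIso.mul_apply, ← (hc i (Nat.lt_succ_of_lt hi)).2 x hx]
        exact hh2 i hi _ (Finset.mem_union_right _ (Finset.mem_image_of_mem _ hx))
      · intro x hx
        rw [RelIso.mul_apply, RelIso.mul_apply, hw' _ (Finset.mem_union_right _
          (Finset.mem_image_of_mem _ (Finset.mem_image_of_mem _ hx)))]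
        simp only [RelIso.mul_apply]
        rw [RelIso.inv_apply_self, (hc n hn).2 x hx]
  · refine ⟨w, A1, hw, ?_⟩
    intro w' hw' h1 h2 h3 h4 h5 h6
    refine absurd ⟨h1, h2, ?_, h4, h5, ?_⟩ hyp
    · intro x hx
      rw [← hw' x (hA hx)]; exact h3 x hx
    · intro x hx
      rw [← hw' x (hA hx)]; exact h6 x hx

/-- The (finite) graph of `b 0, …, b n` on `B`. -/
def graphOf {G : SimpleGraph ℕ} (n : ℕ) (B : Finset ℕ) (b : ℕ → (G ≃g G)) : Finset (ℕ × ℕ × ℕ) :=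
  (Finset.range (n + 1) ×ˢ B).image (fun q => (q.1, q.2, b q.1 q.2))

theorem graphOf_eq {G : SimpleGraph ℕ} {n : ℕ} {B : Finset ℕ} {b b' : ℕ → (G ≃g G)}
    (h : graphOf n B b = graphOf n B b') : ∀ i < n + 1, ∀ x ∈ B, b i x = b' i x := by
  intro i hi x hx
  have h1 : (i, x, b i x) ∈ graphOf n B b :=
    Finset.mem_image.2 ⟨(i, x), by simp [hi, hx], rfl⟩
  rw [h] at h1
  obtain ⟨q, -, hq⟩ := Finset.mem_image.1 h1
  simp only [Prod.mk.injEq] at hq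
  obtain ⟨h3, h4, h5⟩ := hq
  rw [h3, h4] at h5
  exact h5.symm

/-- Index set of the requirements. -/
abbrev Idx : Type := Finset ℕ ⊕ (Finset ℕ × Finset ℕ × Finset (ℕ × ℕ × ℕ))

/-- All requirements. -/
def Req {G : SimpleGraph ℕ} (n : ℕ) (f : ℕ → (G ≃g G)) : Idx → Set (G ≃g G)
  | Sum.inl E => Req1 n f E
  | Sum.inr (A, B, γ) => {u | A ⊆ B → ∀ b : ℕ → (G ≃g G), graphOf n B b = γ → u ∈ Req2 n f A B b}

theorem req_dense {G : SimpleGraph ℕ} (hG : G.ExtensionProperty) {n : ℕ} {f : ℕ → (G ≃g G)}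
    (hf : Gen n f) (i : Idx) : OpenDense (Req n f i) := by
  rcases i with E | ⟨A, B, γ⟩
  · exact dense1 hG hf E
  · intro v E0
    by_cases hγ : ∃ b : ℕ → (G ≃g G), graphOf n B b = γ
    · obtain ⟨b, hb⟩ := hγ
      obtain ⟨w, F, h1, h2⟩ := dense2_aux hG hf A B b v E0
      refine ⟨w, F, h1, fun w' hw' hAB b' hb' => ?_⟩
      have heq := graphOf_eq (hb'.trans hb.symm)
      have hn := Nat.lt_succ_self n
      intro k1 k2 k3 k4 k5 k6
      obtain ⟨h, l1, l2, l3⟩ := h2 w' hw' k1 k2 k3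
        (fun i hi x hx => by rw [← heq i hi x hx]; exact k4 i hi x hx)
        (fun i hi x hx => by
          rw [← heq i (Nat.lt_succ_of_lt hi) x (hAB hx)]; exact k5 i hi x hx)
        (fun x hx => by rw [← heq n hn x (hAB hx)]; exact k6 x hx)
      refine ⟨h, l1, ?_, ?_⟩
      · intro i hi x hx
        rw [heq i (Nat.lt_succ_of_lt hi) x hx]; exact l2 i hi x hx
      · intro x hx
        rw [heq n hn x hx]; exact l3 x hx
    · exact ⟨v, ∅, fun _ _ => rfl, fun w' _ _ b hb => absurd ⟨b, hb⟩ hγ⟩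

theorem gen_succ {G : SimpleGraph ℕ} {n : ℕ} {f : ℕ → (G ≃g G)}
    {u : G ≃g G} (hu : ∀ i, u ∈ Req n f i) : Gen (n + 1) (Function.update f n u) := by
  have han : Function.update f n u n = u := Function.update_self _ _ _
  have haf : ∀ i < n, Function.update f n u i = f i := fun i hi => Function.update_of_ne hi.ne _ _
  have hn := Nat.lt_succ_self n
  constructor
  · intro E
    obtain ⟨A, h1, h2, h3⟩ := hu (Sum.inl E)
    refine ⟨A, h1, ?_⟩
    intro i hi x hx
    rcases Nat.lt_succ_iff_lt_or_eq.1 hi with h | rfl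
    · rw [haf i h]; exact h2 i h x hx
    · rw [han]; exact h3 x hx
  · intro A B b hAB hA hB hb
    obtain ⟨h, l1, l2, l3⟩ := hu (Sum.inr (A, B, graphOf n B b)) hAB b rfl hAB
      (fun i hi x hx => by
        rw [← haf i hi]; exact hA i (Nat.lt_succ_of_lt hi) x hx)
      (fun x hx => by
        have := hA n hn x hx
        rwa [han] at this) hB
      (fun i hi x hx => by
        rw [← haf i hi]; exact hb i (Nat.lt_succ_of_lt hi) x hx)
      (fun x hx => by
        have := hb n hn x hx
        rwa [han] at this)
    refine ⟨h, l1, ?_⟩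
    intro i hi x hx
    rcases Nat.lt_succ_iff_lt_or_eq.1 hi with h | rfl
    · rw [haf i h]; exact l2 i h x hx
    · rw [han]; exact l3 x hx

/-- A pointwise stabilizer not inside `K` contains a generic element outside `K`. -/
theorem exists_generic_notMem {G : SimpleGraph ℕ} (hG : G.ExtensionProperty) {n : ℕ}
    {f : ℕ → (G ≃g G)} (hf : Gen n f) (A : Finset ℕ) (K : Subgroup (G ≃g G))
    (hK : ¬ ∀ g : G ≃g G, (∀ x ∈ A, g x = x) → g ∈ K) :
    ∃ u : G ≃g G, (∀ x ∈ A, u x = x) ∧ Gen (n + 1) (Function.update f n u) ∧ u ∉ K := by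
  push Not at hK
  obtain ⟨g, hg, hgK⟩ := hK
  obtain ⟨u, hu1, hu2⟩ := baire (I := Idx ⊕ Idx)
    (fun i => Sum.elim (fun i => Req n f i) (fun i => {u | g * u ∈ Req n f i}) i)
    (by
      rintro (i | i)
      · exact req_dense hG hf i
      · exact (req_dense hG hf i).translate g) 1 A
  by_cases huK : u ∈ K
  · refine ⟨g * u, ?_, gen_succ (fun i => hu2 (Sum.inr i)), ?_⟩
    · intro x hx
      rw [RelIso.mul_apply, hu1 x hx]
      exact hg x hx
    · intro h
      exact hgK ((K.mul_mem_cancel_right huK).1 h)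
  · exact ⟨u, hu1, gen_succ (fun i => hu2 (Sum.inl i)), huK⟩

theorem exists_generic {G : SimpleGraph ℕ} (hG : G.ExtensionProperty) {n : ℕ}
    {f : ℕ → (G ≃g G)} (hf : Gen n f) (A : Finset ℕ) :
    ∃ u : G ≃g G, (∀ x ∈ A, u x = x) ∧ Gen (n + 1) (Function.update f n u) := by
  obtain ⟨u, hu1, hu2⟩ := baire (fun i => Req n f i) (req_dense hG hf) 1 A
  exact ⟨u, hu1, gen_succ hu2⟩

/-- The map k intertwines the two families on the finite set A. -/
def Conj {G : SimpleGraph ℕ} (n : ℕ) (f f' : ℕ → (G ≃g G)) (k : G ≃g G) (A : Finset ℕ) : Prop :=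
  Inv n f A ∧ ∀ i < n, ∀ x ∈ A, k (f i x) = f' i (k x)

theorem conj_forth {G : SimpleGraph ℕ} {n : ℕ} {f f' : ℕ → (G ≃g G)}
    (hf : Gen n f) (hf' : Gen n f') {k : G ≃g G} {A : Finset ℕ} (hk : Conj n f f' k A)
    (E : Finset ℕ) :
    ∃ (k' : G ≃g G) (A' : Finset ℕ), A ⊆ A' ∧ E ⊆ A' ∧ Conj n f f' k' A' ∧ ∀ x ∈ A, k' x = k x := by
  classical
  obtain ⟨A2, hA2, hinv⟩ := hf.1 (A ∪ E)
  have hAA2 : A ⊆ A2 := Finset.subset_union_left.trans hA2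
  obtain ⟨h, h1, h2⟩ := hf'.2 (A.image k) (A2.image k) (fun i => k * f i * k⁻¹)
    (Finset.image_subset_image hAA2)
    (by
      intro i hi x hx
      obtain ⟨y, hy, rfl⟩ := Finset.mem_image.1 hx
      rw [← hk.2 i hi y hy]
      exact Finset.mem_image_of_mem _ (hk.1 i hi y hy))
    (by
      intro i hi x hx
      obtain ⟨y, hy, rfl⟩ := Finset.mem_image.1 hx
      simp only [RelIso.mul_apply]
      rw [RelIso.inv_apply_self]
      exact Finset.mem_image_of_mem _ (hinv i hi y hy))
    (by
      intro i hi x hx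
      obtain ⟨y, hy, rfl⟩ := Finset.mem_image.1 hx
      simp only [RelIso.mul_apply]
      rw [RelIso.inv_apply_self]
      exact hk.2 i hi y hy)
  refine ⟨h * k, A2, hAA2, Finset.subset_union_right.trans hA2, ⟨hinv, ?_⟩, ?_⟩
  · intro i hi x hx
    have := h2 i hi (k x) (Finset.mem_image_of_mem _ hx)
    simp only [RelIso.mul_apply] at this ⊢
    rwa [RelIso.inv_apply_self] at this
  · intro x hx
    exact h1 _ (Finset.mem_image_of_mem _ hx)

theorem conj_symm {G : SimpleGraph ℕ} {n : ℕ} {f f' : ℕ → (G ≃g G)} {k : G ≃g G} {A : Finset ℕ}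
    [DecidableEq ℕ] (hk : Conj n f f' k A) : Conj n f' f k⁻¹ (A.image k) := by
  constructor
  · intro i hi x hx
    obtain ⟨y, hy, rfl⟩ := Finset.mem_image.1 hx
    rw [← hk.2 i hi y hy]
    exact Finset.mem_image_of_mem _ (hk.1 i hi y hy)
  · intro i hi x hx
    obtain ⟨y, hy, rfl⟩ := Finset.mem_image.1 hx
    rw [← hk.2 i hi y hy, RelIso.inv_apply_self, RelIso.inv_apply_self]

theorem conj_back_forth {G : SimpleGraph ℕ} {n : ℕ} {f f' : ℕ → (G ≃g G)}
    (hf : Gen n f) (hf' : Gen n f') {k : G ≃g G} {A : Finset ℕ} (hk : Conj n f f' k A)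
    (m : ℕ) :
    ∃ (k' : G ≃g G) (A' : Finset ℕ), A ⊆ A' ∧ Conj n f f' k' A' ∧ (∀ x ∈ A, k' x = k x) ∧
      m ∈ A' ∧ ∃ x ∈ A', k' x = m := by
  classical
  obtain ⟨k1, A1, h1, h2, h3, h4⟩ := conj_forth hf hf' hk {m}
  obtain ⟨k2, A2, l1, l2, l3, l4⟩ := conj_forth hf' hf (conj_symm h3) {m}
  have hA1 : ∀ x ∈ A1, k2⁻¹ x = k1 x ∧ x ∈ A2.image k2 := by
    intro x hx
    have hx' := Finset.mem_image_of_mem k1 hx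
    have h5 := l4 _ hx'
    rw [RelIso.inv_apply_self] at h5
    refine ⟨?_, Finset.mem_image.2 ⟨_, l1 hx', h5⟩⟩
    conv_lhs => rw [← h5]
    rw [RelIso.inv_apply_self]
  refine ⟨k2⁻¹, A2.image k2, fun x hx => (hA1 x (h1 hx)).2, conj_symm l3, ?_,
    (hA1 m (h2 (by simp))).2, k2 m, Finset.mem_image_of_mem _ (l2 (by simp)), ?_⟩
  · intro x hx
    rw [(hA1 x (h1 hx)).1, h4 x hx]
  · rw [RelIso.inv_apply_self]

theorem Conj.congr {G : SimpleGraph ℕ} {n : ℕ} {f f' : ℕ → (G ≃g G)} {k : G ≃g G} {A : Finset ℕ}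
    (hk : Conj n f f' k A) {u u' : G ≃g G} (hu : ∀ x ∈ A, u x = x) (hu' : ∀ x ∈ A, u' (k x) = k x) :
    Conj (n + 1) (Function.update f n u) (Function.update f' n u') k A := by
  constructor
  · intro i hi x hx
    rcases Nat.lt_succ_iff_lt_or_eq.1 hi with h | rfl
    · rw [Function.update_of_ne h.ne]; exact hk.1 i h x hx
    · rw [Function.update_self, hu x hx]; exact hx
  · intro i hi x hx
    rcases Nat.lt_succ_iff_lt_or_eq.1 hi with h | rfl
    · rw [Function.update_of_ne h.ne, Function.update_of_ne h.ne]; exact hk.2 i h x hx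
    · rw [Function.update_self, Function.update_self, hu x hx, hu' x hx]

/-- The state of the final construction. -/
structure State (G : SimpleGraph ℕ) where
  f : ℕ → (G ≃g G)
  f' : ℕ → (G ≃g G)
  k : G ≃g G
  A : Finset ℕ

theorem main {G : SimpleGraph ℕ} (hG : G.ExtensionProperty) (H : ℕ → Subgroup (G ≃g G))
    (hmono : Monotone H) (hproper : ∀ n, H n ≠ ⊤) (hunion : ∀ g : G ≃g G, ∃ n, g ∈ H n) :
    False := by
  classical
  have hopen : ∀ j (E : Finset ℕ), ¬ ∀ g : G ≃g G, (∀ x ∈ E, g x = x) → g ∈ H j := by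
    intro j E h
    obtain ⟨t, ht⟩ := open_subgroup hG E
    obtain ⟨m, hm⟩ := hunion t
    exact hproper (max j m) (ht _ (fun g hg => hmono (le_max_left j m) (h g hg))
      (hmono (le_max_right j m) hm))
  obtain ⟨s, -, hs1, hs2⟩ := exists_seq (σ := State G)
    (fun n s => Gen n s.f ∧ Gen n s.f' ∧ Conj n s.f s.f' s.k s.A)
    (fun n s s' => (s.A ⊆ s'.A ∧ (∀ x ∈ s.A, s'.k x = s.k x) ∧ n ∈ s'.A ∧
      ∃ x ∈ s'.A, s'.k x = n) ∧ (∀ i < n, s'.f i = s.f i ∧ s'.f' i = s.f' i) ∧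
      ∃ j, n ≤ j ∧ s'.f n ∈ H j ∧ s'.f' n ∉ H j)
    ⟨fun _ => 1, fun _ => 1, 1, ∅⟩
    ⟨gen_zero _, gen_zero _, fun i hi => absurd hi (Nat.not_lt_zero i),
      fun i hi => absurd hi (Nat.not_lt_zero i)⟩
    (by
      rintro n ⟨f, f', k, A⟩ ⟨hf, hf', hk⟩
      simp only at hf hf' hk
      obtain ⟨u, hu1, hu2⟩ := exists_generic hG hf A
      obtain ⟨j, hj⟩ := hunion u
      obtain ⟨u', hu1', hu2', hu3'⟩ := exists_generic_notMem hG hf' (A.image k) (H (max n j))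
        (hopen _ _)
      obtain ⟨k', A', h1, h2, h3, h4, h5⟩ := conj_back_forth hu2 hu2'
        (hk.congr hu1 (fun x hx => hu1' _ (Finset.mem_image_of_mem _ hx))) n
      refine ⟨⟨Function.update f n u, Function.update f' n u', k', A'⟩, ⟨hu2, hu2', h2⟩,
        ⟨h1, h3, h4, h5⟩, ?_, max n j, le_max_left _ _, ?_, ?_⟩
      · intro i hi
        exact ⟨Function.update_of_ne hi.ne _ _, Function.update_of_ne hi.ne _ _⟩
      · simp only [Function.update_self]
        exact hmono (le_max_right n j) hj
      · simpa only [Function.update_self] using hu3')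
  obtain ⟨k, hk⟩ := limit_fun (G := G) (fun n => (s n).A) (fun n => (s n).k)
    (fun n => (hs2 n).1.1) (fun n => (hs2 n).1.2.1) (fun n => isoOn_aut _ _)
    (fun n => (hs2 n).1.2.2.1) (fun n => (hs2 n).1.2.2.2)
  obtain ⟨N, hN⟩ := hunion k
  obtain ⟨j, hNj, hj1, hj2⟩ := (hs2 N).2.2
  have hstab : ∀ m, N + 1 ≤ m → (s m).f N = (s (N + 1)).f N ∧ (s m).f' N = (s (N + 1)).f' N := by
    intro m hm
    induction m, hm using Nat.le_induction with
    | base => exact ⟨rfl, rfl⟩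
    | succ m hm ih =>
      have := (hs2 m).2.1 N hm
      exact ⟨this.1.trans ih.1, this.2.trans ih.2⟩
  have hA : Monotone (fun n => (s n).A) := monotone_nat_of_le_succ (fun n => (hs2 n).1.1)
  have hconj : ∀ x, k ((s (N + 1)).f N x) = (s (N + 1)).f' N (k x) := by
    intro x
    have hm1 : N + 1 ≤ max (N + 1) (x + 1) := le_max_left _ _
    have hx : x ∈ (s (max (N + 1) (x + 1))).A := hA (le_max_right _ _) (hs2 x).1.2.2.1
    obtain ⟨e1, e2⟩ := hstab _ hm1
    obtain ⟨-, -, c1, c2⟩ := hs1 (max (N + 1) (x + 1))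
    have c1' := c1 N hm1 x hx
    have c2' := c2 N hm1 x hx
    rw [e1] at c1' c2'
    rw [e2] at c2'
    rw [hk _ x hx, hk _ _ c1', c2']
  have heq : (s (N + 1)).f' N = k * (s (N + 1)).f N * k⁻¹ := by
    rw [eq_mul_inv_iff_mul_eq]
    ext x
    exact (hconj x).symm
  apply hj2
  rw [heq]
  exact (H j).mul_mem ((H j).mul_mem (hmono hNj hN) hj1) ((H j).inv_mem (hmono hNj hN))

end RadoCof

/-- The automorphism group of the random graph has uncountable cofinality
(Hodges–Hodkinson–Lascar–Shelah): it is not the union of a countable strictly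
increasing chain of proper subgroups. -/
theorem uncountableCofinality_autRandomGraph (G : SimpleGraph ℕ)
    (hG : G.ExtensionProperty)
    (H : ℕ → Subgroup (G ≃g G))
    (hchain : ∀ n, H n < H (n + 1))
    (hproper : ∀ n, H n ≠ ⊤)
    (hunion : ∀ g : G ≃g G, ∃ n, g ∈ H n) : False := by
  exact RadoCof.main hG H (monotone_nat_of_le_succ (fun n => (hchain n).le)) hproper hunion
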